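/- Let Γ be a finite connected simple graph on v vertices and suppose g is a scale-t embedding of Γ into the n-cube (t ≥ 1). Then t·W(Γ) ≤ n·⌈v/2⌉·⌊v/2⌋, where W(Γ) is the Wiener number of Γ. -/

import Mathlib

/-- `g` is a scale-`t` embedding of the graph `G` into the `n`-cube: the Hamming
distance between images equals `t` times the graph distance. -/
def IsScaleEmbedding {V : Type*} [Fintype V] (G : SimpleGraph V) (t n : ℕ)
    (g : V → (Fin n → Bool)) : Prop :=
  ∀ x y : V, hammingDist (g x) (g y) = t * G.dist x y

/-- The Wiener number of a graph: the sum of the graph distances over all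
unordered pairs of vertices. -/
noncomputable def wiener {V : Type*} [Fintype V] (G : SimpleGraph V) : ℕ :=
  ∑ p ∈ Finset.univ.sym2,
    Sym2.lift ⟨fun x y => G.dist x y, fun x y => G.dist_comm⟩ p

/-- The number of unordered pairs in `s` separated by a two-colouring `b` is the product of the
sizes of the colour classes. -/
theorem sum_sym2_ne_eq_card_mul_card {V : Type*} (b : V → Bool) (s : Finset V) :
    ∑ p ∈ s.sym2, Sym2.lift ⟨fun x y => if b x ≠ b y then 1 else 0,
      fun _ _ => by simp only [ne_comm]⟩ p =
      (s.filter fun x => b x = true).card * (s.filter fun x => b x = false).card := by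
  induction s using Finset.cons_induction with
  | empty => simp
  | cons a s ha ih =>
    rw [Finset.sym2_cons, Finset.sum_disjUnion, ih, Finset.sum_map, Finset.sum_cons,
      Finset.filter_cons, Finset.filter_cons]
    cases h : b a <;> simp [Sym2.mkEmbedding_apply, h, Finset.sum_ite, add_mul, mul_add, add_comm]

theorem mul_le_half_mul_half {a b v : ℕ} (h : a + b = v) :
    a * b ≤ ((v + 1) / 2) * (v / 2) := by
  obtain ⟨k, hk | hk⟩ := v.even_or_odd'
  · rw [show (v + 1) / 2 = k by omega, show v / 2 = k by omega]
    zify at *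
    nlinarith [sq_nonneg ((a : ℤ) - b)]
  · rw [show (v + 1) / 2 = k + 1 by omega, show v / 2 = k by omega]
    rcases le_or_gt a k with hak | hak
    · obtain ⟨c, rfl⟩ := Nat.exists_eq_add_of_le hak
      obtain rfl : b = a + 2 * c + 1 := by omega
      nlinarith
    · obtain ⟨c, rfl⟩ := Nat.exists_eq_add_of_le (show b ≤ k by omega)
      obtain rfl : a = b + 2 * c + 1 := by omega
      nlinarith

/-- If `g` is a scale-`t` embedding of a connected graph `Γ` on `v` vertices into the
`n`-cube, then `t · W(Γ) ≤ n · ⌈v/2⌉ · ⌊v/2⌋`. -/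
theorem wiener_le_of_scale_embedding {V : Type*} [Fintype V] (G : SimpleGraph V)
    (hconn : G.Connected) (v t n : ℕ) (hv : Fintype.card V = v) (ht : 1 ≤ t)
    (g : V → (Fin n → Bool)) (hg : IsScaleEmbedding G t n g) :
    t * wiener G ≤ n * ((v + 1) / 2) * (v / 2) := by
  have key : t * wiener G = ∑ i : Fin n, ∑ p ∈ (Finset.univ : Finset V).sym2,
      Sym2.lift ⟨fun x y => if g x i ≠ g y i then 1 else 0,
        fun _ _ => by simp only [ne_comm]⟩ p := by
    rw [wiener, Finset.mul_sum, Finset.sum_comm]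
    refine Finset.sum_congr rfl fun p _ => ?_
    induction p with
    | h x y =>
      simp only [Sym2.lift_mk, ← hg x y, hammingDist, Finset.card_filter]
  rw [key, mul_assoc]
  calc
    _ ≤ ∑ _i : Fin n, ((v + 1) / 2) * (v / 2) := by
      refine Finset.sum_le_sum fun i _ => ?_
      rw [sum_sym2_ne_eq_card_mul_card fun x => g x i]
      apply mul_le_half_mul_half
      rw [← hv, ← Finset.card_univ,
        ← Finset.card_filter_add_card_filter_not (s := Finset.univ) fun x => g x i = true]
      simp only [Bool.not_eq_true]
    _ = _ := by simp
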